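/- Assume |γ_l(m)| < 1 for all 1 ≤ l ≤ d and 1 ≤ m ≤ M. Let φ_1, …, φ_r ∈ ℝ^V and define the frame operator S : ℝ^V → ℝ^V by S x = Σ_{α ∈ ℕ^d} Σ_{i=1}^r ⟨x, S^α φ_i⟩ S^α φ_i (the series converges absolutely since |γ_l(m)| < 1), and let C(m) ∈ ℝ^{r×r} be the Gram matrix with entries C(m)_{ij} = ⟨P_m φ_i, P_m φ_j⟩. Then S is shift-invariant on S(φ_1,…,φ_r), i.e. S(S_l x) = S_l(S x) for all x ∈ S(φ_1,…,φ_r) and all 1 ≤ l ≤ d, if and only if C(m) C(m') = 0 for all 1 ≤ m ≠ m' ≤ M. -/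

import Mathlib

open Matrix

/-- Standard inner product of graph signals. -/
noncomputable def gdot {V : Type*} [Fintype V] (x y : V → ℝ) : ℝ := ∑ v, x v * y v

/-- The multi-shift `S^α = S_1^{α_1} ⋯ S_d^{α_d}`. -/
noncomputable def Spow {V : Type*} [Fintype V] [DecidableEq V] {d : ℕ}
    (S : Fin d → Matrix V V ℝ) (α : Fin d → ℕ) : Matrix V V ℝ :=
  (List.ofFn fun l => S l ^ α l).prod

/-- The shift-invariant space generated by the graph signals `φ 1, …, φ r`:
the span of all shifts `S^α (φ i)`, `α ∈ ℕ^d`. -/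
noncomputable def gsisSpan {V : Type*} [Fintype V] [DecidableEq V] {d r : ℕ}
    (S : Fin d → Matrix V V ℝ) (φ : Fin r → V → ℝ) : Submodule ℝ (V → ℝ) :=
  Submodule.span ℝ { y | ∃ α : Fin d → ℕ, ∃ i : Fin r, y = (Spow S α) *ᵥ φ i }

/-- The frame operator associated with the generating system
`{S^α φ_i : α ∈ ℕ^d, 1 ≤ i ≤ r}`. -/
noncomputable def frameOp {V : Type*} [Fintype V] [DecidableEq V] {d r : ℕ}
    (S : Fin d → Matrix V V ℝ) (φ : Fin r → V → ℝ) (x : V → ℝ) : V → ℝ :=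
  ∑' α : Fin d → ℕ, ∑ i : Fin r,
    gdot x ((Spow S α) *ᵥ φ i) • ((Spow S α) *ᵥ φ i)


theorem hasSum_pi_geom (d : ℕ) : ∀ (a : Fin d → ℝ), (∀ l, |a l| < 1) →
    HasSum (fun α : Fin d → ℕ => ∏ l, a l ^ α l) (∏ l, (1 - a l)⁻¹) := by
  induction d with
  | zero =>
    intro a _
    simp
  | succ d ih =>
    intro a h
    have h1 := hasSum_geometric_of_abs_lt_one (h 0)
    have h2 := ih (fun l => a l.succ) (fun l => h l.succ)
    have h1n : Summable (fun n : ℕ => ‖a 0 ^ n‖) := by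
      have := (hasSum_geometric_of_abs_lt_one (r := |a 0|) (by simpa using h 0)).summable
      simpa using this
    have h2n : Summable (fun α : Fin d → ℕ => ‖∏ l : Fin d, a l.succ ^ α l‖) := by
      have := (ih (fun l => |a l.succ|) (fun l => by simpa using h l.succ)).summable
      simpa [Finset.abs_prod] using this
    have hs := summable_mul_of_summable_norm (f := fun n : ℕ => a 0 ^ n)
      (g := fun α : Fin d → ℕ => ∏ l : Fin d, a l.succ ^ α l) h1n h2n
    have h3 := HasSum.mul (f := fun n : ℕ => a 0 ^ n)
      (g := fun α : Fin d → ℕ => ∏ l : Fin d, a l.succ ^ α l) h1 h2 hs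
    rw [Fin.prod_univ_succ]
    rw [← (Fin.consEquiv (fun _ : Fin (d + 1) => ℕ)).hasSum_iff]
    have hfun : ((fun α : Fin (d + 1) → ℕ => ∏ l, a l ^ α l) ∘
        (Fin.consEquiv (fun _ : Fin (d + 1) => ℕ))) =
        fun x : ℕ × (Fin d → ℕ) => a 0 ^ x.1 * ∏ l : Fin d, a l.succ ^ x.2 l := by
      funext x
      simp [Fin.prod_univ_succ, Fin.consEquiv]
    rw [hfun]
    exact h3

theorem list_prod_mul_aux {V : Type*} [Fintype V] [DecidableEq V]
    (Q : Matrix V V ℝ) : ∀ (d : ℕ) (A : Fin d → Matrix V V ℝ) (c : Fin d → ℝ),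
    (∀ l, A l * Q = c l • Q) → (List.ofFn A).prod * Q = (∏ l, c l) • Q
  | 0, A, c, h => by simp
  | d + 1, A, c, h => by
    rw [List.ofFn_succ, List.prod_cons, Matrix.mul_assoc,
      list_prod_mul_aux Q d (fun l => A l.succ) (fun l => c l.succ) (fun l => h l.succ),
      Matrix.mul_smul, h 0, smul_smul, Fin.prod_univ_succ, mul_comm]

theorem pow_mul_aux {V : Type*} [Fintype V] [DecidableEq V]
    (A Q : Matrix V V ℝ) (c : ℝ) (h : A * Q = c • Q) (n : ℕ) : A ^ n * Q = c ^ n • Q := by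
  induction n with
  | zero => simp
  | succ n ih => rw [pow_succ, Matrix.mul_assoc, h, Matrix.mul_smul, ih, smul_smul, pow_succ, mul_comm]

theorem Spow_eq {V : Type*} [Fintype V] [DecidableEq V] {d M : ℕ}
    (S : Fin d → Matrix V V ℝ) (γ : Fin M → Fin d → ℝ) (P : Fin M → Matrix V V ℝ)
    (hPsum : ∑ m, P m = (1 : Matrix V V ℝ))
    (hSP : ∀ l m, S l * P m = γ m l • P m) (α : Fin d → ℕ) :
    Spow S α = ∑ m, (∏ l, γ m l ^ α l) • P m := by
  calc Spow S α = Spow S α * ∑ m, P m := by rw [hPsum, Matrix.mul_one]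
    _ = _ := by
      rw [Finset.mul_sum]
      exact Finset.sum_congr rfl fun m _ =>
        list_prod_mul_aux (P m) d _ _ fun l => pow_mul_aux _ _ _ (hSP l m) _

theorem S_mul_Spow {V : Type*} [Fintype V] [DecidableEq V] {d M : ℕ}
    (S : Fin d → Matrix V V ℝ) (γ : Fin M → Fin d → ℝ) (P : Fin M → Matrix V V ℝ)
    (hPsum : ∑ m, P m = (1 : Matrix V V ℝ))
    (hSP : ∀ l m, S l * P m = γ m l • P m) (α : Fin d → ℕ) (l : Fin d) :
    S l * Spow S α = Spow S (α + Pi.single l 1) := by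
  rw [Spow_eq S γ P hPsum hSP, Spow_eq S γ P hPsum hSP, Finset.mul_sum]
  refine Finset.sum_congr rfl fun m _ => ?_
  rw [Matrix.mul_smul, hSP, smul_smul]
  congr 1
  simp only [Pi.add_apply, pow_add, Finset.prod_mul_distrib]
  congr 1
  rw [Finset.prod_eq_single l]
  · simp
  · intro b _ hb
    simp [Pi.single_eq_of_ne hb]
  · simp

theorem gsis_inv {V : Type*} [Fintype V] [DecidableEq V] {d M r : ℕ}
    (S : Fin d → Matrix V V ℝ) (γ : Fin M → Fin d → ℝ) (P : Fin M → Matrix V V ℝ)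
    (hPsum : ∑ m, P m = (1 : Matrix V V ℝ))
    (hSP : ∀ l m, S l * P m = γ m l • P m) (φ : Fin r → V → ℝ) (l : Fin d)
    (x : V → ℝ) (hx : x ∈ gsisSpan S φ) : S l *ᵥ x ∈ gsisSpan S φ := by
  unfold gsisSpan at *
  induction hx using Submodule.span_induction with
  | mem x hx =>
    obtain ⟨α, i, rfl⟩ := hx
    refine Submodule.subset_span ⟨α + Pi.single l 1, i, ?_⟩
    rw [Matrix.mulVec_mulVec, S_mul_Spow S γ P hPsum hSP]
  | zero => simp
  | add x y _ _ hx hy => rw [Matrix.mulVec_add]; exact Submodule.add_mem _ hx hy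
  | smul c x _ hx => rw [Matrix.mulVec_smul]; exact Submodule.smul_mem _ _ hx

theorem proj_mem {V : Type*} [Fintype V] [DecidableEq V] {d M : ℕ}
    (S : Fin d → Matrix V V ℝ) (γ : Fin M → Fin d → ℝ) (hγ : Function.Injective γ)
    (P : Fin M → Matrix V V ℝ)
    (hPsum : ∑ m, P m = (1 : Matrix V V ℝ))
    (hSP : ∀ l m, S l * P m = γ m l • P m) (W : Submodule ℝ (V → ℝ))
    (hW : ∀ l, ∀ x ∈ W, S l *ᵥ x ∈ W) (m : Fin M) (x : V → ℝ) (hx : x ∈ W) :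
    P m *ᵥ x ∈ W := by
  have key : ∀ s : Finset (Fin M), m ∉ s → ∃ c : Fin M → ℝ, c m = 1 ∧ (∀ k ∈ s, c k = 0) ∧
      (∑ k, c k • P k) *ᵥ x ∈ W := by
    intro s
    induction s using Finset.induction_on with
    | empty =>
      intro _
      refine ⟨fun _ => 1, rfl, by simp, ?_⟩
      simpa [hPsum] using hx
    | insert a s ha ih =>
      intro hm
      rw [Finset.mem_insert, not_or] at hm
      obtain ⟨c, hc1, hc0, hc⟩ := ih hm.2
      have : γ m ≠ γ a := fun h => hm.1 (hγ h)
      obtain ⟨l, hl⟩ := Function.ne_iff.mp this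
      have hl' : γ m l - γ a l ≠ 0 := sub_ne_zero.mpr hl
      refine ⟨fun k => (γ m l - γ a l)⁻¹ * ((γ k l - γ a l) * c k), ?_, ?_, ?_⟩
      · simp [hc1, hl']
      · intro k hk
        rcases Finset.mem_insert.mp hk with rfl | hk
        · simp
        · simp [hc0 k hk]
      · have h1 : (γ m l - γ a l)⁻¹ • (S l *ᵥ ((∑ k, c k • P k) *ᵥ x)
            - γ a l • ((∑ k, c k • P k) *ᵥ x)) ∈ W :=
          W.smul_mem _ (W.sub_mem (hW l _ hc) (W.smul_mem _ hc))
        convert h1 using 1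
        rw [Matrix.mulVec_mulVec, ← Matrix.smul_mulVec, ← Matrix.sub_mulVec, ← Matrix.smul_mulVec]
        congr 1
        rw [Finset.mul_sum, Finset.smul_sum, ← Finset.sum_sub_distrib, Finset.smul_sum]
        refine Finset.sum_congr rfl fun k _ => ?_
        rw [Matrix.mul_smul, hSP]
        module
  obtain ⟨c, hc1, hc0, hc⟩ := key (Finset.univ.erase m) (by simp)
  rw [Finset.sum_eq_single m] at hc
  · simpa [hc1] using hc
  · intro k _ hk
    rw [hc0 k (by simp [hk]), zero_smul]
  · simp

theorem gdot_mulVec {V : Type*} [Fintype V] (A : Matrix V V ℝ) (x y : V → ℝ) :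
    gdot (A *ᵥ x) y = gdot x (Aᵀ *ᵥ y) := by
  change (A *ᵥ x) ⬝ᵥ y = x ⬝ᵥ (Aᵀ *ᵥ y)
  rw [Matrix.dotProduct_mulVec, Matrix.vecMul_transpose]

/-- A block of the frame operator. -/
noncomputable def Tblk {V : Type*} [Fintype V] {r : ℕ} (A B : Matrix V V ℝ)
    (φ : Fin r → V → ℝ) : (V → ℝ) →ₗ[ℝ] (V → ℝ) where
  toFun x := ∑ i, gdot x (A *ᵥ φ i) • (B *ᵥ φ i)
  map_add' x y := by
    simp only [gdot, Pi.add_apply, add_mul, Finset.sum_add_distrib, add_smul]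
  map_smul' c x := by
    simp only [gdot, Pi.smul_apply, smul_eq_mul, mul_assoc, ← Finset.mul_sum, mul_smul,
      ← Finset.smul_sum, RingHom.id_apply]

theorem Tblk_apply {V : Type*} [Fintype V] {r : ℕ} (A B : Matrix V V ℝ)
    (φ : Fin r → V → ℝ) (x : V → ℝ) :
    Tblk A B φ x = ∑ i, gdot x (A *ᵥ φ i) • (B *ᵥ φ i) := rfl

theorem mulVec_Tblk {V : Type*} [Fintype V] {r : ℕ} (A B C : Matrix V V ℝ)
    (φ : Fin r → V → ℝ) (x : V → ℝ) : C *ᵥ Tblk A B φ x = Tblk A (C * B) φ x := by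
  simp only [Tblk_apply, Matrix.mulVec_sum, Matrix.mulVec_smul, Matrix.mulVec_mulVec]

theorem Tblk_mulVec {V : Type*} [Fintype V] {r : ℕ} (A B C : Matrix V V ℝ)
    (φ : Fin r → V → ℝ) (x : V → ℝ) : Tblk A B φ (C *ᵥ x) = Tblk (Cᵀ * A) B φ x := by
  simp only [Tblk_apply, gdot_mulVec, Matrix.mulVec_mulVec]

theorem Tblk_smul_left {V : Type*} [Fintype V] {r : ℕ} (A B : Matrix V V ℝ) (c : ℝ)
    (φ : Fin r → V → ℝ) (x : V → ℝ) : Tblk (c • A) B φ x = c • Tblk A B φ x := by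
  simp only [Tblk_apply, Finset.smul_sum, smul_smul, Matrix.smul_mulVec]
  refine Finset.sum_congr rfl fun i _ => ?_
  congr 1
  exact dotProduct_smul c x (A *ᵥ φ i)

theorem Tblk_smul_right {V : Type*} [Fintype V] {r : ℕ} (A B : Matrix V V ℝ) (c : ℝ)
    (φ : Fin r → V → ℝ) (x : V → ℝ) : Tblk A (c • B) φ x = c • Tblk A B φ x := by
  simp only [Tblk_apply, Finset.smul_sum, Matrix.smul_mulVec]
  exact Finset.sum_congr rfl fun i _ => smul_comm _ _ _

theorem Tblk_sum_left {V : Type*} [Fintype V] {r M : ℕ} (A : Fin M → Matrix V V ℝ)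
    (B : Matrix V V ℝ)
    (φ : Fin r → V → ℝ) (x : V → ℝ) : Tblk (∑ m, A m) B φ x = ∑ m, Tblk (A m) B φ x := by
  simp only [Tblk_apply]
  rw [Finset.sum_comm]
  refine Finset.sum_congr rfl fun i _ => ?_
  rw [← Finset.sum_smul, Matrix.sum_mulVec]
  congr 1
  exact dotProduct_sum x Finset.univ _

theorem Tblk_sum_right {V : Type*} [Fintype V] {r M : ℕ} (A : Matrix V V ℝ)
    (B : Fin M → Matrix V V ℝ)
    (φ : Fin r → V → ℝ) (x : V → ℝ) : Tblk A (∑ m, B m) φ x = ∑ m, Tblk A (B m) φ x := by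
  simp only [Tblk_apply]
  rw [Finset.sum_comm]
  refine Finset.sum_congr rfl fun i _ => ?_
  rw [← Finset.smul_sum, Matrix.sum_mulVec]

theorem frameOp_eq {V : Type*} [Fintype V] [DecidableEq V] {d M r : ℕ}
    (S : Fin d → Matrix V V ℝ) (γ : Fin M → Fin d → ℝ) (P : Fin M → Matrix V V ℝ)
    (hPsum : ∑ m, P m = (1 : Matrix V V ℝ))
    (hSP : ∀ l m, S l * P m = γ m l • P m)
    (hbound : ∀ m l, |γ m l| < 1) (φ : Fin r → V → ℝ) (x : V → ℝ) :
    frameOp S φ x =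
      ∑ a, ∑ b, (∏ l, (1 - γ a l * γ b l)⁻¹) • Tblk (P a) (P b) φ x := by
  unfold frameOp
  refine HasSum.tsum_eq ?_
  have h : HasSum (fun α : Fin d → ℕ =>
      ∑ a, ∑ b, (∏ l, (γ a l * γ b l) ^ α l) • Tblk (P a) (P b) φ x)
      (∑ a, ∑ b, (∏ l, (1 - γ a l * γ b l)⁻¹) • Tblk (P a) (P b) φ x) := by
    refine hasSum_sum fun a _ => hasSum_sum fun b _ => HasSum.smul_const ?_ _
    refine hasSum_pi_geom d _ fun l => ?_
    rw [abs_mul]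
    exact mul_lt_one_of_nonneg_of_lt_one_left (abs_nonneg _) (hbound a l) (hbound b l).le
  convert h using 1
  funext α
  change Tblk (Spow S α) (Spow S α) φ x = _
  rw [Spow_eq S γ P hPsum hSP, Tblk_sum_left]
  refine Finset.sum_congr rfl fun a _ => ?_
  rw [Tblk_sum_right]
  refine Finset.sum_congr rfl fun b _ => ?_
  rw [Tblk_smul_left, Tblk_smul_right, smul_smul, ← Finset.prod_mul_distrib]
  simp only [mul_pow]

theorem stmt17
    {V : Type*} [Fintype V] [DecidableEq V] [Nonempty V]
    (hN : 2 ≤ Fintype.card V)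
    {d M : ℕ} (hd : 1 ≤ d) (hM : 1 ≤ M)
    (S : Fin d → Matrix V V ℝ)
    (hSsym : ∀ l, (S l)ᵀ = S l)
    (hScomm : ∀ l l', S l * S l' = S l' * S l)
    (γ : Fin M → Fin d → ℝ) (hγ : Function.Injective γ)
    (P : Fin M → Matrix V V ℝ)
    (hPne : ∀ m, P m ≠ 0)
    (hPsym : ∀ m, (P m)ᵀ = P m)
    (hPidem : ∀ m, P m * P m = P m)
    (hPorth : ∀ m m', m ≠ m' → P m * P m' = 0)
    (hPsum : ∑ m, P m = (1 : Matrix V V ℝ))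
    (hSP : ∀ l m, S l * P m = γ m l • P m)
    (hPS : ∀ l m, P m * S l = γ m l • P m)
    (hbound : ∀ m l, |γ m l| < 1)
    (r : ℕ) (φ : Fin r → V → ℝ) :
    (∀ x ∈ gsisSpan S φ, ∀ l : Fin d,
        frameOp S φ ((S l) *ᵥ x) = (S l) *ᵥ frameOp S φ x) ↔
      ∀ m m' : Fin M, m ≠ m' →
        (Matrix.of fun i j : Fin r => gdot ((P m) *ᵥ φ i) ((P m) *ᵥ φ j)) *
          (Matrix.of fun i j : Fin r => gdot ((P m') *ᵥ φ i) ((P m') *ᵥ φ j)) = 0 := by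
  have hadj : ∀ a b l x, Tblk (P a) (P b) φ (S l *ᵥ x) = γ a l • Tblk (P a) (P b) φ x := by
    intro a b l x
    rw [Tblk_mulVec, hSsym, hSP, Tblk_smul_left]
  have hout : ∀ a b l x, S l *ᵥ Tblk (P a) (P b) φ x = γ b l • Tblk (P a) (P b) φ x := by
    intro a b l x
    rw [mulVec_Tblk, hSP, Tblk_smul_right]
  have hzero : ∀ (A : Matrix V V ℝ) (x : V → ℝ), Tblk 0 A φ x = 0 := by
    intro A x
    simpa using Tblk_smul_left A A 0 φ x
  have hzero' : ∀ (A : Matrix V V ℝ) (x : V → ℝ), Tblk A 0 φ x = 0 := by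
    intro A x
    simpa using Tblk_smul_right A A 0 φ x
  have hF := frameOp_eq S γ P hPsum hSP hbound φ
  have hC : ∀ m m' : Fin M,
      ((Matrix.of fun i j : Fin r => gdot ((P m) *ᵥ φ i) ((P m) *ᵥ φ j)) *
          (Matrix.of fun i j : Fin r => gdot ((P m') *ᵥ φ i) ((P m') *ᵥ φ j)) = 0) ↔
      ∀ j, Tblk (P m) (P m') φ (P m *ᵥ φ j) = 0 := by
    intro m m'
    have hent : ∀ j k, ((Matrix.of fun i j : Fin r => gdot ((P m) *ᵥ φ i) ((P m) *ᵥ φ j)) *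
          (Matrix.of fun i j : Fin r => gdot ((P m') *ᵥ φ i) ((P m') *ᵥ φ j))) j k =
        Tblk (P m) (P m') φ (P m *ᵥ φ j) ⬝ᵥ (P m' *ᵥ φ k) := by
      intro j k
      rw [Tblk_apply, sum_dotProduct, Matrix.mul_apply]
      refine Finset.sum_congr rfl fun i _ => ?_
      rw [smul_dotProduct]
      rfl
    constructor
    · intro h j
      rw [← dotProduct_self_eq_zero]
      conv_lhs =>
        arg 1
        rw [Tblk_apply (P m) (P m') φ]
      rw [sum_dotProduct]
      refine Finset.sum_eq_zero fun k _ => ?_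
      rw [smul_dotProduct, dotProduct_comm, ← hent j k, h]
      simp
    · intro h
      ext j k
      rw [hent, h j]
      simp
  constructor
  · intro h m m' hmm
    rw [hC]
    intro j
    have hj : φ j ∈ gsisSpan S φ := by
      refine Submodule.subset_span ⟨0, j, ?_⟩
      have : Spow S (0 : Fin d → ℕ) = 1 := by
        rw [Spow_eq S γ P hPsum hSP]
        simpa using hPsum
      rw [this, Matrix.one_mulVec]
    have hx : P m *ᵥ φ j ∈ gsisSpan S φ :=
      proj_mem S γ hγ P hPsum hSP _ (gsis_inv S γ P hPsum hSP φ) m _ hj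
    obtain ⟨l, hl⟩ := Function.ne_iff.mp (fun e => hmm (hγ e) : γ m ≠ γ m')
    have e := congrArg (fun y => P m' *ᵥ y) (h _ hx l)
    simp only [hF, hadj, Matrix.mulVec_sum, Matrix.mulVec_smul, hout, mulVec_Tblk] at e
    have hT : ∀ a b, a ≠ m → Tblk (P a) b φ (P m *ᵥ φ j) = 0 := by
      intro a b ha
      rw [Tblk_mulVec, hPsym, hPorth m a (Ne.symm ha), hzero]
    have hcol : ∀ g : Fin M → Fin M → ℝ, ∑ a, ∑ b, g a b • Tblk (P a) (P m' * P b) φ (P m *ᵥ φ j)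
        = g m m' • Tblk (P m) (P m') φ (P m *ᵥ φ j) := by
      intro g
      rw [Finset.sum_eq_single m, Finset.sum_eq_single m', hPidem]
      · intro b _ hb
        rw [hPorth m' b (Ne.symm hb), hzero', smul_zero]
      · simp
      · intro a _ ha
        exact Finset.sum_eq_zero fun b _ => by rw [hT a _ ha, smul_zero]
      · simp
    simp only [smul_smul] at e
    rw [hcol (fun a b => (∏ l, (1 - γ a l * γ b l)⁻¹) * γ a l),
      hcol (fun a b => (∏ l, (1 - γ a l * γ b l)⁻¹) * γ b l), ← sub_eq_zero, ← sub_smul,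
      ← mul_sub] at e
    refine (smul_eq_zero.mp e).resolve_left (mul_ne_zero ?_ (sub_ne_zero.mpr hl))
    refine Finset.prod_ne_zero_iff.mpr fun k _ => inv_ne_zero ?_
    have : |γ m k * γ m' k| < 1 := by
      rw [abs_mul]
      exact mul_lt_one_of_nonneg_of_lt_one_left (abs_nonneg _) (hbound m k) (hbound m' k).le
    have := (abs_lt.mp this).2
    linarith
  · intro h x hx l
    have hT : ∀ a b, a ≠ b → Tblk (P a) (P b) φ x = 0 := by
      intro a b hab
      have h0 := (hC a b).mp (h a b hab)
      unfold gsisSpan at hx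
      induction hx using Submodule.span_induction with
      | mem x hx =>
        obtain ⟨α, j, rfl⟩ := hx
        have : Tblk (P a) (P b) φ (Spow S α *ᵥ φ j)
            = (∏ l, γ a l ^ α l) • Tblk (P a) (P b) φ (P a *ᵥ φ j) := by
          rw [Spow_eq S γ P hPsum hSP, Matrix.sum_mulVec, map_sum, Finset.sum_eq_single a]
          · rw [Matrix.smul_mulVec, map_smul]
          · intro k _ hk
            rw [Matrix.smul_mulVec, map_smul, Tblk_mulVec, hPsym, hPorth k a hk, hzero, smul_zero]
          · simp
        rw [this, h0, smul_zero]
      | zero => simp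
      | add x y _ _ hx hy => rw [map_add, hx, hy, add_zero]
      | smul c x _ hx => rw [map_smul, hx, smul_zero]
    rw [hF, hF]
    simp only [Matrix.mulVec_sum, Matrix.mulVec_smul, hout, hadj]
    refine Finset.sum_congr rfl fun a _ => Finset.sum_congr rfl fun b _ => ?_
    by_cases hab : a = b
    · rw [hab]
    · simp only [hT a b hab, smul_zero]
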